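/- For any two ∃-saturated maximal FOL□-consistent sets Γ, Δ ∈ MC and any □-free formula A: ◇A ∈ Γ if and only if ◇A ∈ Δ. -/

import Mathlib

namespace FOLBoxPaper

/-- Formulas of the language L(∀,□): atoms `P_j(x₁,…,xₙ)` (predicate index and
list of variables), identity `x = y`, negation, implication, universal
quantification, and the modal operator □. Variables are natural numbers. -/
inductive Formula : Type
  | atom : ℕ → List ℕ → Formula
  | eq : ℕ → ℕ → Formula
  | neg : Formula → Formula
  | imp : Formula → Formula → Formula
  | all : ℕ → Formula → Formula
  | box : Formula → Formula

namespace Formula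

/-- Conjunction, defined as usual. -/
def and (A B : Formula) : Formula := neg (imp A (neg B))

/-- Disjunction, defined as usual. -/
def or (A B : Formula) : Formula := imp (neg A) B

/-- Biconditional, defined as usual. -/
def iff (A B : Formula) : Formula := (imp A B).and (imp B A)

/-- ◇A := ¬□¬A. -/
def dia (A : Formula) : Formula := neg (box (neg A))

/-- ∃xA := ¬∀x¬A. -/
def ex (x : ℕ) (A : Formula) : Formula := neg (all x (neg A))

/-- A formula is □-free when it contains no occurrence of □. -/
def BoxFree : Formula → Prop
  | atom _ _ => True
  | eq _ _ => True
  | neg A => BoxFree A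
  | imp A B => BoxFree A ∧ BoxFree B
  | all _ A => BoxFree A
  | box _ => False

/-- `FreeIn x A`: the variable x has at least one ∀□-free occurrence in A,
i.e. an occurrence that is neither in the scope of a quantifier binding x
nor in the scope of □. -/
def FreeIn (x : ℕ) : Formula → Prop
  | atom _ args => x ∈ args
  | eq a b => x = a ∨ x = b
  | neg A => FreeIn x A
  | imp A B => FreeIn x A ∨ FreeIn x B
  | all z A => z ≠ x ∧ FreeIn x A
  | box _ => False

/-- The ∀□-free substitution `A(y/x)`: replace every ∀□-free occurrence of x
in A by y (occurrences in the scope of □ or of a quantifier binding x are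
left untouched). -/
def subst (A : Formula) (y x : ℕ) : Formula :=
  match A with
  | atom j args => atom j (args.map fun z => if z = x then y else z)
  | eq a b => eq (if a = x then y else a) (if b = x then y else b)
  | neg A => neg (subst A y x)
  | imp A B => imp (subst A y x) (subst B y x)
  | all z A => if z = x then all z A else all z (subst A y x)
  | box A => box A

/-- `Substitutable y x A`: the variable y is substitutable for the ∀□-free
occurrences of x in A, i.e. y is not captured by a quantifier when it
replaces x. -/
def Substitutable (y x : ℕ) : Formula → Prop
  | atom _ _ => True
  | eq _ _ => True
  | neg A => Substitutable y x A
  | imp A B => Substitutable y x A ∧ Substitutable y x B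
  | all z A => z = x ∨ ¬ FreeIn x A ∨ (z ≠ y ∧ Substitutable y x A)
  | box _ => True

end Formula

open Formula

/-- A first-order structure with variable domains:
a nonempty set of possible worlds, a nonempty domain of objects for each
world, and a world-relative interpretation of the predicate symbols. -/
structure Structure where
  W : Type
  wNonempty : Nonempty W
  D : W → Type
  dNonempty : ∀ w, Nonempty (D w)
  I : ℕ → (w : W) → List (D w) → Prop

/-- A valuation assigns, to each variable and world, an object of the domain
of that world. -/
def Valuation (M : Structure) : Type := ℕ → (w : M.W) → M.D w

open Classical in
/-- The variant `v^a_x(w)` of a valuation v at world w: it maps x at w to a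
and agrees with v everywhere else. -/
noncomputable def updateVal {M : Structure} (v : Valuation M) (x : ℕ)
    (w : M.W) (a : M.D w) : Valuation M :=
  fun y w' => if h : y = x ∧ w' = w then cast (congrArg M.D h.2.symm) a else v y w'

/-- Satisfaction `M, v, w ⊨ A`. The clause for □ quantifies over all
valuations and all worlds of the structure. -/
def Sat (M : Structure) : Valuation M → M.W → Formula → Prop
  | v, w, .atom j args => M.I j w (args.map fun z => v z w)
  | v, w, .eq a b => v a w = v b w
  | v, w, .neg A => ¬ Sat M v w A
  | v, w, .imp A B => Sat M v w A → Sat M v w B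
  | v, w, .all x A => ∀ a : M.D w, Sat M (updateVal v x w a) w A
  | _, _, .box A => ∀ (v' : Valuation M) (w' : M.W), Sat M v' w' A

/-- `M ⊨ A`: A is satisfied at every valuation and world of M. -/
def Models (M : Structure) (A : Formula) : Prop := ∀ v w, Sat M v w A

/-- Universal structures: M is universal when every □-free formula true
everywhere in M is true everywhere in every structure. -/
def Universal (M : Structure) : Prop :=
  ∀ B, BoxFree B → Models M B → ∀ N : Structure, Models N B

/-- Logical validity: truth at every valuation and world of every universal
structure. -/
def Valid (A : Formula) : Prop :=
  ∀ M : Structure, Universal M → ∀ (v : Valuation M) (w : M.W), Sat M v w A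

/-- FOL: the set of □-free classical first-order theses, i.e. □-free formulas
satisfied at every valuation and world of every structure. -/
def FOL : Set Formula := {A | BoxFree A ∧ ∀ M : Structure, Models M A}

/-- `PropTaut A`: A is an instantiation of a tautology of classical
propositional logic (it is true under every assignment of truth values to
formulas that respects ¬ and →). -/
def PropTaut (A : Formula) : Prop :=
  ∀ f : Formula → Prop,
    (∀ B, f (neg B) ↔ ¬ f B) → (∀ B C, f (imp B C) ↔ (f B → f C)) → f A

/-- The system FOL□. -/
inductive FOLBox : Formula → Prop
  | taut {A} : PropTaut A → FOLBox A
  | axK {A B} : FOLBox ((box (A.imp B)).imp ((box A).imp (box B)))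
  | axT {A} : FOLBox ((box A).imp A)
  | ax5 {A} : FOLBox ((neg (box A)).imp (box (neg (box A))))
  | axAll1 {A : Formula} {x y : ℕ} : Substitutable y x A →
      FOLBox ((all x A).imp (A.subst y x))
  | axAll2 {A B : Formula} {x : ℕ} : ¬ FreeIn x A →
      FOLBox ((all x (A.imp B)).imp (A.imp (all x B)))
  | axId {x : ℕ} : FOLBox (Formula.eq x x)
  | axEq {A : Formula} {x y : ℕ} : BoxFree A → Substitutable y x A →
      FOLBox (((Formula.eq x y).and A).imp (A.subst y x))
  | axMix {A : Formula} {x : ℕ} : FOLBox ((box A).imp (all x A))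
  | axBang {A} : BoxFree A → A ∉ FOL → FOLBox (neg (box A))
  | mp {A B} : FOLBox (A.imp B) → FOLBox A → FOLBox B
  | nec {A} : FOLBox A → FOLBox (box A)

/-- The conjunction of a (nonempty) finite list of formulas. -/
def conjList : List Formula → Formula
  | [] => Formula.eq 0 0
  | [A] => A
  | A :: B :: rest => A.and (conjList (B :: rest))

/-- FOL□-consistency: no finite conjunction of members of Γ has its negation
in FOL□. -/
def Consistent (Γ : Set Formula) : Prop :=
  ∀ L : List Formula, L ≠ [] → (∀ B ∈ L, B ∈ Γ) → ¬ FOLBox (neg (conjList L))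

/-- Maximal FOL□-consistency. -/
def MaxConsistent (Γ : Set Formula) : Prop :=
  Consistent Γ ∧ ∀ A, A ∈ Γ ∨ neg A ∈ Γ

/-- ∃-saturation: whenever ¬∀xA ∈ Γ there is a variable y with
¬A(y/x) ∈ Γ via a ∀□-free substitution. -/
def Saturated (Γ : Set Formula) : Prop :=
  ∀ (x : ℕ) (A : Formula), neg (all x A) ∈ Γ →
    ∃ y : ℕ, Substitutable y x A ∧ neg (A.subst y x) ∈ Γ

/-- MC: the family of all ∃-saturated maximal FOL□-consistent sets. -/
def MC : Set (Set Formula) := {Γ | Saturated Γ ∧ MaxConsistent Γ}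

/-- An elementary disjunction: a formula of the form
`A ∨ ◇B ∨ □C₁ ∨ … ∨ □Cₙ` with A, B, C₁, …, Cₙ □-free. -/
def ElemDisj (D : Formula) : Prop :=
  ∃ (A B : Formula) (Cs : List Formula),
    BoxFree A ∧ BoxFree B ∧ (∀ C ∈ Cs, BoxFree C) ∧
    D = (Cs.map Formula.box).foldl Formula.or (A.or B.dia)

/-- A conjunctive form: a conjunction of elementary disjunctions. -/
def ConjForm (F : Formula) : Prop :=
  ∃ Ds : List Formula, Ds ≠ [] ∧ (∀ D ∈ Ds, ElemDisj D) ∧ F = conjList Ds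

/-- The worlds of the canonical structure: members of MC. -/
def MCW : Type := {Γ : Set Formula // Γ ∈ MC}

/-- The relation ∼_Γ on variables: x ∼_Γ y iff the formula x = y belongs
to Γ. -/
def canonRel (Γ : MCW) (x y : ℕ) : Prop := Formula.eq x y ∈ Γ.val

/-- The canonical structure 𝒜^MC: worlds are the members of MC, the domain
of a world Γ consists of the classes [x]_{∼_Γ} of variables, and a predicate
holds of such classes iff the corresponding atomic formula belongs to Γ. -/
noncomputable def canonicalStructure (h : Nonempty MCW) : Structure where
  W := MCW
  wNonempty := h
  D := fun Γ => Quot (canonRel Γ)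
  dNonempty := fun Γ => ⟨Quot.mk _ 0⟩
  I := fun j Γ ds =>
    ∃ xs : List ℕ, ds = xs.map (Quot.mk (canonRel Γ)) ∧ Formula.atom j xs ∈ Γ.val

/-- The canonical valuation v^MC: v^MC(x, Γ) = [x]_{∼_Γ}. -/
noncomputable def canonicalVal (h : Nonempty MCW) : Valuation (canonicalStructure h) :=
  fun x Γ => Quot.mk (canonRel Γ) x

namespace Formula

/-- `VarsLT N A`: every variable of A outside the scope of □, free or bound, is below N. -/
def VarsLT (N : ℕ) : Formula → Prop
  | atom _ args => ∀ z ∈ args, z < N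
  | eq a b => a < N ∧ b < N
  | neg A => VarsLT N A
  | imp A B => VarsLT N A ∧ VarsLT N B
  | all z A => z < N ∧ VarsLT N A
  | box _ => True

/-- Simultaneous replacement of the ∀□-free occurrences of variables along σ, without any
precaution against capture. -/
def rename (σ : ℕ → ℕ) : Formula → Formula
  | atom j args => atom j (args.map σ)
  | eq a b => eq (σ a) (σ b)
  | neg A => neg (rename σ A)
  | imp A B => imp (rename σ A) (rename σ B)
  | all z A => all z (rename (Function.update σ z z) A)
  | box A => box A

/-- Universal quantification over all variables below a bound. -/
def univClosure : ℕ → Formula → Formula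
  | 0, A => A
  | n + 1, A => all n (univClosure n A)

theorem VarsLT.mono {M N : ℕ} (h : M ≤ N) {A : Formula} (hA : VarsLT M A) : VarsLT N A := by
  induction A with
  | atom j args => exact fun z hz => (hA z hz).trans_le h
  | eq a b => exact ⟨hA.1.trans_le h, hA.2.trans_le h⟩
  | neg A ih => exact ih hA
  | imp A B ihA ihB => exact ⟨ihA hA.1, ihB hA.2⟩
  | all z A ih => exact ⟨hA.1.trans_le h, ih hA.2⟩
  | box A => trivial

theorem exists_varsLT (A : Formula) : ∃ N, VarsLT N A := by
  induction A with
  | atom j args =>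
    exact ⟨args.sum + 1, fun z hz => Nat.lt_succ_of_le (List.le_sum_of_mem hz)⟩
  | eq a b => exact ⟨a + b + 1, by simp only [VarsLT]; omega⟩
  | neg A ih => exact ih
  | imp A B ihA ihB =>
    obtain ⟨M, hM⟩ := ihA
    obtain ⟨N, hN⟩ := ihB
    exact ⟨max M N, hM.mono (le_max_left _ _), hN.mono (le_max_right _ _)⟩
  | all z A ih =>
    obtain ⟨M, hM⟩ := ih
    exact ⟨max (z + 1) M, by omega, hM.mono (le_max_right _ _)⟩
  | box A => exact ⟨0, trivial⟩

theorem FreeIn.lt {N x : ℕ} {A : Formula} (hx : FreeIn x A) (hA : VarsLT N A) : x < N := by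
  induction A with
  | atom j args => exact hA x hx
  | eq a b => rcases hx with rfl | rfl <;> [exact hA.1; exact hA.2]
  | neg A ih => exact ih hx hA
  | imp A B ihA ihB => exact hx.elim (fun h => ihA h hA.1) (fun h => ihB h hA.2)
  | all z A ih => exact ih hx.2 hA.2
  | box A => exact hx.elim

theorem VarsLT.not_freeIn {y : ℕ} {A : Formula} (hA : VarsLT y A) : ¬ FreeIn y A :=
  fun h => lt_irrefl y (h.lt hA)

theorem subst_self (A : Formula) (x : ℕ) : A.subst x x = A := by
  have key (z : ℕ) : (if z = x then x else z) = z := by split_ifs <;> simp_all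
  induction A with
  | atom j args => simp only [subst, key, List.map_id']
  | all z A ih => simp [subst, ih]
  | _ => simp_all [subst]

theorem substitutable_self (A : Formula) (x : ℕ) : Substitutable x x A := by
  induction A with
  | all z A ih =>
    by_cases h : z = x
    · exact Or.inl h
    · exact Or.inr (Or.inr ⟨h, ih⟩)
  | _ => simp_all [Substitutable]

theorem map_subst_of_notMem {x y : ℕ} {l : List ℕ} (h : x ∉ l) :
    (l.map fun z => if z = x then y else z) = l := by
  refine (List.map_congr_left fun z hz => ?_).trans (List.map_id l)
  simp [show z ≠ x from fun e => h (e ▸ hz)]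

theorem subst_of_not_freeIn {x y : ℕ} {A : Formula} (h : ¬ FreeIn x A) : A.subst y x = A := by
  induction A with
  | atom j args => simp only [subst, map_subst_of_notMem h]
  | eq a b =>
    simp only [FreeIn, not_or] at h
    simp [subst, Ne.symm h.1, Ne.symm h.2]
  | neg A ih => simp only [subst, ih h]
  | imp A B ihA ihB =>
    simp only [FreeIn, not_or] at h
    simp only [subst, ihA h.1, ihB h.2]
  | all z A ih =>
    by_cases hz : z = x
    · simp [subst, hz]
    · simp only [subst, hz, if_false, ih fun hA => h ⟨hz, hA⟩]
  | box A => rfl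

theorem subst_subst_of_varsLT {x y : ℕ} {A : Formula} (hA : VarsLT y A) :
    (A.subst y x).subst x y = A := by
  have key {z : ℕ} (hz : z < y) :
      (if (if z = x then y else z) = y then x else if z = x then y else z) = z := by
    have := hz.ne
    split_ifs <;> simp_all
  induction A with
  | atom j args =>
    simp only [subst, List.map_map]
    congr 1
    exact (List.map_congr_left fun z hz => key (hA z hz)).trans (List.map_id _)
  | eq a b => simp only [subst, key hA.1, key hA.2]
  | neg A ih => simp only [subst, ih hA]
  | imp A B ihA ihB => simp only [subst, ihA hA.1, ihB hA.2]
  | all z A ih =>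
    by_cases hz : z = x
    · simp [subst, hz, subst_of_not_freeIn hA.2.not_freeIn]
    · simp [subst, hz, hA.1.ne, ih hA.2]
  | box A => rfl

theorem substitutable_subst_of_varsLT {x y : ℕ} {A : Formula} (hA : VarsLT y A) :
    Substitutable x y (A.subst y x) := by
  induction A with
  | atom j args => trivial
  | eq a b => trivial
  | neg A ih => exact ih hA
  | imp A B ihA ihB => exact ⟨ihA hA.1, ihB hA.2⟩
  | all z A ih =>
    by_cases hz : z = x
    · simp [subst, hz, Substitutable, hA.2.not_freeIn]
    · simp [subst, hz, Substitutable, ih hA.2]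
  | box A => trivial

theorem not_freeIn_subst {x y : ℕ} (hxy : x ≠ y) (A : Formula) : ¬ FreeIn x (A.subst y x) := by
  have key (z : ℕ) : x ≠ if z = x then y else z := by split_ifs <;> grind
  induction A with
  | atom j args =>
    simp only [subst, FreeIn, List.mem_map, not_exists, not_and]
    exact fun z _ => (key z).symm
  | eq a b => simp [subst, FreeIn, key]
  | neg A ih => exact ih
  | imp A B ihA ihB => exact not_or.2 ⟨ihA, ihB⟩
  | all z A ih =>
    by_cases hz : z = x
    · simp [subst, hz, FreeIn]
    · simp [subst, hz, FreeIn, ih]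
  | box A => exact id

theorem substitutable_of_varsLT {N x y : ℕ} (hy : N ≤ y) {A : Formula} (hA : VarsLT N A) :
    Substitutable y x A := by
  induction A with
  | all z A ih => exact Or.inr (Or.inr ⟨(hA.1.trans_le hy).ne, ih hA.2⟩)
  | imp A B ihA ihB => exact ⟨ihA hA.1, ihB hA.2⟩
  | neg A ih => exact ih hA
  | _ => trivial

theorem rename_congr {σ τ : ℕ → ℕ} {A : Formula} (h : ∀ x, FreeIn x A → σ x = τ x) :
    rename σ A = rename τ A := by
  induction A generalizing σ τ with
  | atom j args => simp only [rename, List.map_congr_left h]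
  | eq a b => simp only [rename, h a (Or.inl rfl), h b (Or.inr rfl)]
  | neg A ih => simp only [rename, ih h]
  | imp A B ihA ihB =>
    simp only [rename, ihA fun x hx => h x (Or.inl hx), ihB fun x hx => h x (Or.inr hx)]
  | all z A ih =>
    simp only [rename]
    rw [ih fun x hx => ?_]
    by_cases hz : x = z
    · simp [hz]
    · simp [hz, h x ⟨Ne.symm hz, hx⟩]
  | box A => rfl

theorem rename_id (A : Formula) : rename id A = A := by
  have key (z : ℕ) : Function.update id z z = (id : ℕ → ℕ) := Function.update_eq_self z id
  induction A with
  | all z A ih => simp only [rename, key, ih]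
  | _ => simp_all [rename]

theorem rename_of_closed {A : Formula} (h : ∀ x, ¬ FreeIn x A) (σ : ℕ → ℕ) : rename σ A = A :=
  (rename_congr fun x hx => (h x hx).elim).trans (rename_id A)

theorem substitutable_rename {N x y : ℕ} (hy : N ≤ y) {A : Formula} (hA : VarsLT N A)
    (σ : ℕ → ℕ) : Substitutable y x (rename σ A) := by
  induction A generalizing σ with
  | all z A ih => exact Or.inr (Or.inr ⟨(hA.1.trans_le hy).ne, ih hA.2 _⟩)
  | imp A B ihA ihB => exact ⟨ihA hA.1 _, ihB hA.2 _⟩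
  | neg A ih => exact ih hA _
  | _ => trivial

theorem subst_rename {x y : ℕ} (A : Formula) {σ : ℕ → ℕ} (hσ : ∀ z, σ z = x → z = x) :
    (rename σ A).subst y x = rename (fun z => if σ z = x then y else σ z) A := by
  induction A generalizing σ with
  | atom j args => simp [rename, subst, Function.comp_def]
  | eq a b => rfl
  | neg A ih => simp only [rename, subst, ih hσ]
  | imp A B ihA ihB => simp only [rename, subst, ihA hσ, ihB hσ]
  | all w A ih =>
    by_cases hw : w = x
    · subst hw
      simp only [rename, subst, if_true]
      congr 2
      funext z
      by_cases hz : z = w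
      · simp [hz]
      · simp [hz, show σ z ≠ w from fun e => hz (hσ z e)]
    · simp only [rename, subst, hw, if_false]
      rw [ih fun z hz => ?_]
      · congr 2
        funext z
        by_cases hz : z = w
        · simp [hz, hw]
        · simp [hz]
      · by_cases hzw : z = w
        · simpa [hzw] using hz
        · exact hσ z (by simpa [hzw] using hz)
  | box A => rfl

theorem FreeIn.of_univClosure {n x : ℕ} {A : Formula} (h : FreeIn x (univClosure n A)) :
    n ≤ x ∧ FreeIn x A := by
  induction n with
  | zero => exact ⟨Nat.zero_le x, h⟩
  | succ n ih =>
    have := ih h.2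
    exact ⟨lt_of_le_of_ne this.1 h.1, this.2⟩

theorem VarsLT.univClosure {n N : ℕ} {A : Formula} (hA : VarsLT N A) (hn : n ≤ N) :
    VarsLT N (univClosure n A) := by
  induction n with
  | zero => exact hA
  | succ n ih => exact ⟨hn, ih (Nat.le_of_succ_le hn)⟩

theorem BoxFree.univClosure {A : Formula} (hA : BoxFree A) (n : ℕ) :
    BoxFree (univClosure n A) := by
  induction n with
  | zero => exact hA
  | succ n ih => exact ih

/-- A numbering of formulas. -/
def code : Formula → ℕ
  | atom j args => Nat.pair 0 (Nat.pair j (Encodable.encode args))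
  | eq a b => Nat.pair 1 (Nat.pair a b)
  | neg A => Nat.pair 2 (code A)
  | imp A B => Nat.pair 3 (Nat.pair (code A) (code B))
  | all z A => Nat.pair 4 (Nat.pair z (code A))
  | box A => Nat.pair 5 (code A)

theorem code_injective : Function.Injective code := by
  intro A
  induction A <;> intro B <;> cases B <;> simp_all [code, Nat.pair_eq_pair] <;> grind

instance : Countable Formula := code_injective.countable

end Formula

theorem Models.univClosure {M : Structure} {A : Formula} (h : Models M A) (n : ℕ) :
    Models M (A.univClosure n) := by
  induction n with
  | zero => exact h
  | succ n ih => exact fun _ w _ => ih _ w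

namespace FOLBox

theorem gen {A : Formula} (x : ℕ) (h : FOLBox A) : FOLBox (all x A) :=
  axMix.mp h.nec

theorem substitution {A : Formula} {x y : ℕ} (h : FOLBox A) (hs : Substitutable y x A) :
    FOLBox (A.subst y x) :=
  (axAll1 hs).mp (h.gen x)

theorem of_univClosure {n : ℕ} {A : Formula} (h : FOLBox (A.univClosure n)) : FOLBox A := by
  induction n with
  | zero => exact h
  | succ n ih =>
    have := (axAll1 (substitutable_self _ n)).mp h
    rw [subst_self] at this
    exact ih this

theorem imp_self (A : Formula) : FOLBox (A.imp A) :=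
  taut fun f _ hi => by simp only [hi]; tauto

theorem imp_trans {A B C : Formula} (h₁ : FOLBox (A.imp B)) (h₂ : FOLBox (B.imp C)) :
    FOLBox (A.imp C) :=
  ((taut fun f _ hi => by simp only [hi]; tauto :
    FOLBox ((A.imp B).imp ((B.imp C).imp (A.imp C)))).mp h₁).mp h₂

theorem imp_intro {A : Formula} (h : FOLBox A) (F : Formula) : FOLBox (F.imp A) :=
  (taut fun f _ hi => by simp only [hi]; tauto : FOLBox (A.imp (F.imp A))).mp h

theorem imp_mp {F A B : Formula} (h₁ : FOLBox (F.imp (A.imp B))) (h₂ : FOLBox (F.imp A)) :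
    FOLBox (F.imp B) :=
  ((taut fun f _ hi => by simp only [hi]; tauto :
    FOLBox ((F.imp (A.imp B)).imp ((F.imp A).imp (F.imp B)))).mp h₁).mp h₂

theorem neg_of_imp_of_imp_neg {F A : Formula} (h₁ : FOLBox (F.imp A))
    (h₂ : FOLBox (F.imp (neg A))) : FOLBox (neg F) :=
  ((taut fun f hn hi => by simp only [hi, hn]; tauto :
    FOLBox ((F.imp A).imp ((F.imp (neg A)).imp (neg F)))).mp h₁).mp h₂

theorem and_left (A B : Formula) : FOLBox ((A.and B).imp A) :=
  taut fun f hn hi => by simp only [Formula.and, hi, hn]; tauto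

theorem and_right (A B : Formula) : FOLBox ((A.and B).imp B) :=
  taut fun f hn hi => by simp only [Formula.and, hi, hn]; tauto

theorem imp_neg_of_neg_and {F A : Formula} (h : FOLBox (neg (F.and A))) :
    FOLBox (F.imp (neg A)) :=
  (taut fun f hn hi => by simp only [Formula.and, hi, hn]; tauto :
    FOLBox ((neg (F.and A)).imp (F.imp (neg A)))).mp h

theorem curry {A B C : Formula} (h : FOLBox ((A.and B).imp C)) : FOLBox (A.imp (B.imp C)) :=
  (taut fun f hn hi => by simp only [Formula.and, hi, hn]; tauto :
    FOLBox (((A.and B).imp C).imp (A.imp (B.imp C)))).mp h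

theorem neg_neg_elim (A : Formula) : FOLBox ((neg (neg A)).imp A) :=
  taut fun f hn hi => by simp only [hi, hn]; tauto

theorem eq_euclidean (a b c : ℕ) :
    FOLBox ((Formula.eq a b).imp ((Formula.eq a c).imp (Formula.eq b c))) := by
  obtain ⟨z, hz⟩ := Infinite.exists_notMem_finset ({a, b} : Finset ℕ)
  simp only [Finset.mem_insert, Finset.mem_singleton, not_or] at hz
  have h₁ : FOLBox _ := axEq (A := Formula.eq a z) (x := a) (y := b) trivial trivial
  have h₂ := (curry h₁).substitution (x := z) (y := c) (by simp [Substitutable, Formula.subst])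
  simpa [Formula.subst, hz.1, hz.2, Ne.symm hz.1, Ne.symm hz.2] using h₂

theorem atom_congr (j a b : ℕ) (p q : List ℕ) :
    FOLBox ((Formula.eq a b).imp
      ((Formula.atom j (p ++ a :: q)).imp (Formula.atom j (p ++ b :: q)))) := by
  obtain ⟨z, hz⟩ := Infinite.exists_notMem_finset (b :: (p ++ q)).toFinset
  simp only [List.mem_toFinset, List.mem_cons, List.mem_append, not_or] at hz
  have h₁ : FOLBox _ :=
    axEq (A := Formula.atom j (p ++ z :: q)) (x := z) (y := b) trivial trivial
  have h₂ := (curry h₁).substitution (x := z) (y := a) (by simp [Substitutable, Formula.subst])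
  simpa [Formula.subst, Ne.symm hz.1, map_subst_of_notMem hz.2.1, map_subst_of_notMem hz.2.2]
    using h₂

theorem imp_all_of_fresh {F A : Formula} {x y : ℕ} (hF : VarsLT y F)
    (hA : VarsLT y (all x A)) (h : FOLBox (F.imp (A.subst y x))) : FOLBox (F.imp (all x A)) := by
  have h₁ : FOLBox (F.imp (all y (A.subst y x))) := (axAll2 hF.not_freeIn).mp (h.gen y)
  have h₂ := axAll1 (substitutable_subst_of_varsLT (x := x) hA.2)
  rw [subst_subst_of_varsLT hA.2] at h₂
  have h₃ : ¬ FreeIn x (all y (A.subst y x)) :=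
    fun hx => not_freeIn_subst hA.1.ne A hx.2
  exact h₁.imp_trans ((axAll2 h₃).mp (h₂.gen x))

end FOLBox

/-- Deductively closed complete sets of formulas in which every false universal formula is
refuted by a variable not below N. -/
structure IsHenkin (N : ℕ) (G : Set Formula) : Prop where
  of_folBox : ∀ {A}, FOLBox A → A ∈ G
  mp : ∀ {A B}, Formula.imp A B ∈ G → A ∈ G → B ∈ G
  neg_mem : ∀ {A}, neg A ∈ G ↔ A ∉ G
  witness : ∀ {x A}, neg (all x A) ∈ G → ∃ k, neg (A.subst (N + k) x) ∈ G

theorem exists_henkin_step (N : ℕ) {F : Formula} (hF : ¬ FOLBox (neg F)) (A : Formula) :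
    ∃ F', ¬ FOLBox (neg F') ∧ FOLBox (F'.imp F) ∧
      (FOLBox (F'.imp A) ∨ FOLBox (F'.imp (neg A))) ∧
      ∀ x C, A = neg (all x C) → FOLBox (F'.imp A) →
        ∃ k, FOLBox (F'.imp (neg (C.subst (N + k) x))) := by
  by_cases hFA : FOLBox (neg (F.and A))
  · have h := hFA.imp_neg_of_neg_and
    exact ⟨F, hF, .imp_self F, .inr h,
      fun x C _ hA => (hF (hA.neg_of_imp_of_imp_neg h)).elim⟩
  by_cases hA : ∃ x C, A = neg (all x C)
  · obtain ⟨x, C, rfl⟩ := hA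
    obtain ⟨K, hK⟩ := exists_varsLT (F.and (neg (all x C)))
    have hK' := hK.mono (Nat.le_add_left K N)
    have hle := FOLBox.and_left (F.and (neg (all x C))) (neg (C.subst (N + K) x))
    refine ⟨_, fun h => hFA ?_, hle.imp_trans (.and_left _ _),
      .inl (hle.imp_trans (.and_right _ _)), ?_⟩
    · exact (FOLBox.imp_all_of_fresh hK' hK'.2
        (h.imp_neg_of_neg_and.imp_trans (.neg_neg_elim _))).neg_of_imp_of_imp_neg (.and_right _ _)
    · rintro x' C' h -
      obtain ⟨rfl, rfl⟩ : x = x' ∧ C = C' := by simpa using h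
      exact ⟨K, .and_right _ _⟩
  · exact ⟨_, hFA, .and_left _ _, .inl (.and_right _ _),
      fun x C h => (hA ⟨x, C, h⟩).elim⟩

theorem exists_isHenkin (N : ℕ) {F : Formula} (hF : ¬ FOLBox (neg F)) :
    ∃ G, IsHenkin N G ∧ F ∈ G := by
  have : Nonempty Formula := ⟨F⟩
  obtain ⟨e, he⟩ := exists_surjective_nat Formula
  choose g hcons himp hdec hwit using
    fun (F : {F // ¬ FOLBox (neg F)}) (A : Formula) => exists_henkin_step N F.2 A
  let s : ℕ → {F // ¬ FOLBox (neg F)} :=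
    fun n => n.rec ⟨F, hF⟩ fun n F => ⟨g F (e n), hcons F (e n)⟩
  have hmono {m n : ℕ} (h : m ≤ n) : FOLBox ((s n).1.imp (s m).1) := by
    induction h with
    | refl => exact .imp_self _
    | step _ ih => exact (himp _ _).imp_trans ih
  refine ⟨{A | ∃ n, FOLBox ((s n).1.imp A)}, ⟨?_, ?_, ?_, ?_⟩, 0, .imp_self _⟩
  · exact fun h => ⟨0, h.imp_intro _⟩
  · rintro A B ⟨m, hm⟩ ⟨n, hn⟩
    exact ⟨max m n, ((hmono (le_max_left m n)).imp_trans hm).imp_mp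
      ((hmono (le_max_right m n)).imp_trans hn)⟩
  · intro A
    constructor
    · rintro ⟨m, hm⟩ ⟨n, hn⟩
      exact (s (max m n)).2 (((hmono (le_max_right m n)).imp_trans hn).neg_of_imp_of_imp_neg
        ((hmono (le_max_left m n)).imp_trans hm))
    · intro h
      obtain ⟨n, rfl⟩ := he A
      exact (hdec (s n) (e n)).elim (fun h' => (h ⟨n + 1, h'⟩).elim) fun h' => ⟨n + 1, h'⟩
  · rintro x C ⟨m, hm⟩
    obtain ⟨n, hn⟩ := he (neg (all x C))
    have hpos : FOLBox ((s (n + 1)).1.imp (e n)) := by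
      refine (hdec (s n) (e n)).resolve_right fun h => ?_
      have h' : FOLBox ((s (n + 1)).1.imp (neg (neg (all x C)))) := hn ▸ h
      exact (s (max m (n + 1))).2
        (((hmono (le_max_left _ _)).imp_trans hm).neg_of_imp_of_imp_neg
          ((hmono (le_max_right _ _)).imp_trans h'))
    obtain ⟨k, hk⟩ := hwit (s n) (e n) x C hn hpos
    exact ⟨k, n + 1, hk⟩

namespace IsHenkin

variable {N : ℕ} {G : Set Formula}

theorem imp_mem (hG : IsHenkin N G) {A B : Formula} : A.imp B ∈ G ↔ (A ∈ G → B ∈ G) := by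
  refine ⟨hG.mp, fun h => ?_⟩
  by_cases hA : A ∈ G
  · exact hG.mp (hG.of_folBox (.taut fun f _ hi => by simp only [hi]; tauto)) (h hA)
  · exact hG.mp (hG.of_folBox (.taut fun f hn hi => by simp only [hi, hn]; tauto))
      (hG.neg_mem.2 hA)

theorem eq_euclidean (hG : IsHenkin N G) {a b c : ℕ} (h₁ : Formula.eq a b ∈ G)
    (h₂ : Formula.eq a c ∈ G) : Formula.eq b c ∈ G :=
  hG.mp (hG.mp (hG.of_folBox (.eq_euclidean a b c)) h₁) h₂

theorem eq_refl (hG : IsHenkin N G) (a : ℕ) : Formula.eq a a ∈ G :=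
  hG.of_folBox .axId

theorem eq_symm (hG : IsHenkin N G) {a b : ℕ} (h : Formula.eq a b ∈ G) : Formula.eq b a ∈ G :=
  hG.eq_euclidean h (hG.eq_refl a)

theorem atom_mem_of_forall₂ (hG : IsHenkin N G) {j : ℕ} {l l' : List ℕ}
    (h : List.Forall₂ (fun a b => Formula.eq a b ∈ G) l l') (p : List ℕ)
    (hl : Formula.atom j (p ++ l) ∈ G) : Formula.atom j (p ++ l') ∈ G := by
  induction h generalizing p with
  | nil => exact hl
  | @cons a b q q' hab _ ih =>
    have := hG.mp (hG.mp (hG.of_folBox (.atom_congr j a b p q)) hab) hl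
    simpa using ih (p ++ [b]) (by simpa using this)

/-- Equality, according to G, of the variables not below N. -/
def setoid (hG : IsHenkin N G) : Setoid ℕ where
  r a b := Formula.eq (N + a) (N + b) ∈ G
  iseqv := ⟨fun _ => hG.eq_refl _, hG.eq_symm, fun h₁ h₂ => hG.eq_euclidean (hG.eq_symm h₁) h₂⟩

/-- The one-world structure of classes of variables not below N. -/
def termStructure (hG : IsHenkin N G) : Structure where
  W := Unit
  wNonempty := ⟨()⟩
  D _ := Quotient hG.setoid
  dNonempty _ := ⟨Quotient.mk _ 0⟩
  I j _ ds := Formula.atom j (ds.map fun d => N + d.out) ∈ G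

/-- The valuation sending each variable x to the class of σ x. -/
def termVal (hG : IsHenkin N G) (σ : ℕ → ℕ) : Valuation hG.termStructure :=
  fun x _ => Quotient.mk hG.setoid (σ x)

theorem updateVal_termVal (hG : IsHenkin N G) (σ : ℕ → ℕ) (x k : ℕ) :
    updateVal (hG.termVal σ) x () (Quotient.mk hG.setoid k : hG.termStructure.D ()) =
      hG.termVal (Function.update σ x k) := by
  funext y w
  by_cases h : y = x
  · subst h
    simp only [updateVal, termVal, Function.update_self]
    exact (dif_pos ⟨rfl, rfl⟩).trans rfl
  · simp only [updateVal, termVal, Function.update_of_ne h]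
    exact dif_neg fun h' => h h'.1

theorem sat_iff_mem (hG : IsHenkin N G) {A : Formula} (hA : BoxFree A) (hN : VarsLT N A)
    (σ : ℕ → ℕ) :
    Sat hG.termStructure (hG.termVal σ) () A ↔ A.rename (fun x => N + σ x) ∈ G := by
  induction A generalizing σ with
  | atom j args =>
    have hout (x : ℕ) : Formula.eq (N + (Quotient.mk hG.setoid (σ x)).out) (N + σ x) ∈ G :=
      Quotient.mk_out (s := hG.setoid) (σ x)
    have hsat : Sat hG.termStructure (hG.termVal σ) () (.atom j args) ↔
        Formula.atom j (args.map fun x => N + (Quotient.mk hG.setoid (σ x)).out) ∈ G := by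
      refine Iff.trans Iff.rfl (iff_of_eq (congrArg (fun l => Formula.atom j l ∈ G) ?_))
      exact List.map_map
    rw [hsat]
    constructor <;> refine fun h => hG.atom_mem_of_forall₂ ?_ [] h
    · simpa [List.forall₂_map_left_iff, List.forall₂_map_right_iff, List.forall₂_same]
        using fun x _ => hout x
    · simpa [List.forall₂_map_left_iff, List.forall₂_map_right_iff, List.forall₂_same]
        using fun x _ => hG.eq_symm (hout x)
  | eq a b => exact Quotient.eq (r := hG.setoid)
  | neg A ih => exact (not_congr (ih hA hN σ)).trans hG.neg_mem.symm
  | imp A B ihA ihB =>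
    exact (imp_congr (ihA hA.1 hN.1 σ) (ihB hA.2 hN.2 σ)).trans hG.imp_mem.symm
  | all x A ih =>
    have hsub (k : ℕ) :
        (A.rename (Function.update (fun z => N + σ z) x x)).subst (N + k) x =
          A.rename (fun z => N + Function.update σ x k z) := by
      have hx (z : ℕ) : N + σ z ≠ x := by have := hN.1; omega
      rw [subst_rename]
      · congr 1
        funext z
        by_cases hz : z = x
        · simp [hz]
        · simp [hz, hx]
      · intro z hz
        by_contra hzx
        exact hx z (by simpa [hzx] using hz)
    have hsat : Sat hG.termStructure (hG.termVal σ) () (.all x A) ↔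
        ∀ k, A.rename (fun z => N + Function.update σ x k z) ∈ G := by
      refine Iff.trans ?_ (forall_congr' fun k => ih hA hN.2 (Function.update σ x k))
      constructor
      · intro h k
        rw [← hG.updateVal_termVal]
        exact h _
      · intro h d
        induction d using Quotient.inductionOn with
        | h k =>
          have := h k
          rwa [← hG.updateVal_termVal] at this
    rw [hsat]
    constructor
    · intro h
      by_contra hall
      obtain ⟨k, hk⟩ := hG.witness (hG.neg_mem.2 hall)
      rw [hsub] at hk
      exact hG.neg_mem.1 hk (h k)
    · intro h k
      rw [← hsub]
      exact hG.mp (hG.of_folBox (.axAll1 (substitutable_rename (Nat.le_add_right N k) hN.2 _))) h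
  | box A => exact hA.elim

end IsHenkin

/-- Completeness for first-order logic: every □-free thesis is derivable. -/
theorem FOLBox.of_mem_FOL {A : Formula} (hA : A ∈ FOL) : FOLBox A := by
  obtain ⟨N, hN⟩ := exists_varsLT A
  by_contra hnot
  have hclosed (x : ℕ) : ¬ FreeIn x (A.univClosure N) := fun hx =>
    hx.of_univClosure.1.not_gt (hx.of_univClosure.2.lt hN)
  obtain ⟨G, hG, hmem⟩ := exists_isHenkin N (F := neg (A.univClosure N))
    fun h => hnot ((FOLBox.neg_neg_elim _).mp h).of_univClosure
  refine hG.neg_mem.1 hmem ?_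
  have := (hG.sat_iff_mem (hA.1.univClosure N) (hN.univClosure le_rfl) id).1
    ((hA.2 hG.termStructure).univClosure N _ ())
  rwa [rename_of_closed hclosed] at this

theorem MaxConsistent.neg_notMem_of_folBox {Γ : Set Formula} (hΓ : MaxConsistent Γ)
    {A : Formula} (hA : FOLBox A) : neg A ∉ Γ := by
  refine fun h => hΓ.1 [neg A] (by simp) (by simpa using h) ?_
  exact (FOLBox.taut fun f hn hi => by simp only [hi, hn]; tauto :
    FOLBox (A.imp (neg (neg A)))).mp hA

theorem MaxConsistent.mem_of_folBox {Γ : Set Formula} (hΓ : MaxConsistent Γ) {A : Formula}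
    (hA : FOLBox A) : A ∈ Γ :=
  (hΓ.2 A).resolve_right (hΓ.neg_notMem_of_folBox hA)

/-- for Γ, Δ ∈ MC and □-free A, ◇A ∈ Γ iff ◇A ∈ Δ. -/
theorem dia_boxfree_agree (Γ Δ : Set Formula) (hΓ : Γ ∈ MC) (hΔ : Δ ∈ MC)
    (A : Formula) (hA : Formula.BoxFree A) :
    Formula.dia A ∈ Γ ↔ Formula.dia A ∈ Δ := by
  by_cases h : neg A ∈ FOL
  · have hbox := (FOLBox.of_mem_FOL h).nec
    exact iff_of_false (hΓ.2.neg_notMem_of_folBox hbox) (hΔ.2.neg_notMem_of_folBox hbox)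
  · have hdia : FOLBox (dia A) := .axBang hA h
    exact iff_of_true (hΓ.2.mem_of_folBox hdia) (hΔ.2.mem_of_folBox hdia)

end FOLBoxPaper
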